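/- Let μ be the Gauss measure on [0,1), T the Gauss map, and ψ(n) ≥ 2 a function. Let A_n^k = {x ∈ [0,1) : a_k(x) ≥ ψ(n)}. There exist constants C > 0 and 0 < γ < 1 such that: whenever 1 = k₀ ≤ k₁ < k₂ < ⋯ < k_r ≤ n satisfy k_{j+1} − k_j − 1 ≥ (log n)² for all 0 ≤ j ≤ r−1, one has μ(A_n^1)^r (1 − C γ^{log n})^{r−1} ≤ μ(⋂_{j=1}^r A_n^{k_j}) ≤ μ(A_n^1)^r (1 + C γ^{log n})^{r−1}. -/

import Mathlib

open MeasureTheory Filter Set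

/-- The Gauss map. -/
noncomputable def gaussMap (x : ℝ) : ℝ := if x = 0 then 0 else 1 / x - ⌊(1 / x : ℝ)⌋

/-- The `k`-th partial quotient of the continued fraction expansion of `x` (for `k ≥ 1`). -/
noncomputable def cfa (k : ℕ) (x : ℝ) : ℕ := ⌊1 / (gaussMap^[k - 1] x)⌋₊

/-- The Gauss measure on `[0,1)`, with density `1/((1+x) log 2)` w.r.t. Lebesgue measure. -/
noncomputable def gaussμ : Measure ℝ :=
  (volume.restrict (Set.Ico (0 : ℝ) 1)).withDensity
    fun x => ENNReal.ofReal (1 / ((1 + x) * Real.log 2))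

/-- The set `A_n^k = {x ∈ [0,1) : a_k(x) ≥ ψ(n)}`. -/
noncomputable def Aset (ψ : ℕ → ℝ) (n k : ℕ) : Set ℝ :=
  {x ∈ Set.Ico (0 : ℝ) 1 | ψ n ≤ (cfa k x : ℝ)}

open scoped ENNReal

noncomputable def gp (n : ℕ) (x : ℝ) : ℝ := (x + 1) / ((x + n + 1) * (x + n + 2))
noncomputable def gu (n : ℕ) (x : ℝ) : ℝ := 1 / (x + n + 1)
noncomputable def UE (h : ℝ → ℝ≥0∞) (x : ℝ) : ℝ≥0∞ := ∑' n, ENNReal.ofReal (gp n x) * h (gu n x)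
noncomputable def UR (h : ℝ → ℝ) (x : ℝ) : ℝ := (UE (fun y => ENNReal.ofReal (h y)) x).toReal
noncomputable def gw (x : ℝ) : ℝ := 1 / ((1 + x) * Real.log 2)

/-- The invariant cone. -/
structure Cone (f : ℝ → ℝ) : Prop where
  meas : Measurable f
  nonneg : ∀ x ∈ Ioo (0:ℝ) 1, 0 ≤ f x
  up : ∀ x ∈ Ioo (0:ℝ) 1, ∀ y ∈ Ioo (0:ℝ) 1, x ≤ y → (1 + x) * f x ≤ (1 + y) * f y
  down : ∀ x ∈ Ioo (0:ℝ) 1, ∀ y ∈ Ioo (0:ℝ) 1, x ≤ y → (1 + x) * f y ≤ (1 + y) * f x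

lemma gp_nonneg (n : ℕ) {x : ℝ} (hx : 0 ≤ x) : 0 ≤ gp n x := by
  unfold gp; positivity

lemma gu_mem (n : ℕ) {x : ℝ} (hx : x ∈ Ioo (0:ℝ) 1) : gu n x ∈ Ioo (0:ℝ) 1 := by
  obtain ⟨h0, h1⟩ := hx
  unfold gu
  have : (0:ℝ) ≤ n := n.cast_nonneg
  constructor
  · positivity
  · rw [div_lt_one (by positivity)]; linarith

lemma HasSum.congr_fun' {f g : ℕ → ℝ} {a : ℝ} (h : HasSum f a) (e : ∀ n, f n = g n) : HasSum g a := by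
  have : f = g := funext e
  rwa [← this]

lemma tel_hasSum (a : ℕ → ℝ) (ha : Tendsto a atTop (nhds 0)) (h : ∀ n, a (n+1) ≤ a n) :
    HasSum (fun n => a n - a (n+1)) (a 0) := by
  rw [hasSum_iff_tendsto_nat_of_nonneg (fun n => sub_nonneg.2 (h n))]
  simp_rw [Finset.sum_range_sub']
  simpa using ha.const_sub (a 0)

lemma inv_tendsto (x : ℝ) : Tendsto (fun n : ℕ => (x + n + 1)⁻¹) atTop (nhds 0) := by
  apply tendsto_inv_atTop_zero.comp
  apply tendsto_atTop_add_const_right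
  exact tendsto_atTop_add_const_left _ _ tendsto_natCast_atTop_atTop

lemma gp_hasSum {x : ℝ} (hx : 0 ≤ x) : HasSum (fun n => gp n x) 1 := by
  have h := tel_hasSum (fun n => (x+1) * (x + n + 1)⁻¹)
    (by simpa using (inv_tendsto x).const_mul (x+1))
    (by intro n; push_cast; gcongr; simp)
  convert h using 1
  · funext n
    unfold gp
    have : (0:ℝ) ≤ n := n.cast_nonneg
    push_cast
    field_simp
    ring
  · simp; field_simp

noncomputable def rho (u : ℝ) : ℝ := u + u / (1 + u)

lemma rho_hasSum {x : ℝ} (hx : 0 ≤ x) : HasSum (fun n => gp n x * rho (gu n x)) (1 / (1 + x)) := by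
  have h := tel_hasSum (fun n => (x+1) * ((x + n + 1)⁻¹)^2)
    (by simpa using ((inv_tendsto x).pow 2).const_mul (x+1))
    (by intro n; push_cast; gcongr; simp)
  convert h using 1
  · funext n
    unfold gp rho gu
    have : (0:ℝ) ≤ n := n.cast_nonneg
    push_cast
    field_simp
    ring
  · simp; field_simp; ring

lemma gu_anti (n : ℕ) {x y : ℝ} (hx : 0 ≤ x) (h : x ≤ y) : gu n y ≤ gu n x := by
  unfold gu; gcongr

/-- stochastic monotonicity -/
lemma mono_key {f : ℝ → ℝ} (hf : ∀ x ∈ Ioo (0:ℝ) 1, ∀ y ∈ Ioo (0:ℝ) 1, x ≤ y → f x ≤ f y)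
    {x y a b : ℝ} (hx : x ∈ Ioo (0:ℝ) 1) (hy : y ∈ Ioo (0:ℝ) 1) (hxy : x ≤ y)
    (ha : HasSum (fun n => gp n x * f (gu n x)) a) (hb : HasSum (fun n => gp n y * f (gu n y)) b) :
    b ≤ a := by
  set c := f (gu 1 y)
  have h1 := ha.sub ((gp_hasSum hx.1.le).mul_right c)
  have h2 := hb.sub ((gp_hasSum hy.1.le).mul_right c)
  have := hasSum_le ?_ h2 h1
  · linarith
  intro n
  have hA : f (gu n y) ≤ f (gu n x) := hf _ (gu_mem n hy) _ (gu_mem n hx) (gu_anti n hx.1.le hxy)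
  have hpx := gp_nonneg n hx.1.le
  have hn : (0:ℝ) ≤ n := n.cast_nonneg
  have hd : gp n y - gp n x = (y - x) * ((n+1)*n - (1+x)*(1+y)) /
      (((x + n + 1) * (x + n + 2)) * ((y + n + 1) * (y + n + 2))) := by
    have := hx.1; have := hy.1
    unfold gp; field_simp; ring
  have hB : (gp n y - gp n x) * (f (gu n y) - c) ≤ 0 := by
    have hx0 := hx.1; have hy0 := hy.1
    have hx1 := hx.2; have hy1 := hy.2
    rcases Nat.lt_trichotomy n 1 with h | h | h
    · have h0 : n = 0 := by omega
      subst h0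
      apply mul_nonpos_of_nonpos_of_nonneg
      · rw [hd]
        apply div_nonpos_of_nonpos_of_nonneg _ (by positivity)
        apply mul_nonpos_of_nonneg_of_nonpos (by linarith)
        simp only [CharP.cast_eq_zero, mul_zero, zero_sub, Left.neg_nonpos_iff]; positivity
      · rw [sub_nonneg]
        apply hf _ (gu_mem _ hy) _ (gu_mem _ hy)
        unfold gu; gcongr
    · subst h; simp [c]
    · have hn2 : (2:ℝ) ≤ n := by exact_mod_cast h
      apply mul_nonpos_of_nonneg_of_nonpos
      · rw [hd]
        apply div_nonneg _ (by positivity)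
        apply mul_nonneg (by linarith)
        nlinarith
      · rw [sub_nonpos]
        apply hf _ (gu_mem _ hy) _ (gu_mem _ hy)
        unfold gu; gcongr; 
  nlinarith

lemma UR_spec {h : ℝ → ℝ} {M : ℝ} (h0 : ∀ x ∈ Ioo (0:ℝ) 1, 0 ≤ h x)
    (h1 : ∀ x ∈ Ioo (0:ℝ) 1, h x ≤ M) {x : ℝ} (hx : x ∈ Ioo (0:ℝ) 1) :
    HasSum (fun n => gp n x * h (gu n x)) (UR h x) ∧
    UE (fun y => ENNReal.ofReal (h y)) x = ENNReal.ofReal (UR h x) := by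
  have hnn : ∀ n, 0 ≤ gp n x * h (gu n x) := fun n =>
    mul_nonneg (gp_nonneg n hx.1.le) (h0 _ (gu_mem n hx))
  have hs : Summable (fun n => gp n x * h (gu n x)) := by
    refine Summable.of_nonneg_of_le hnn (fun n => ?_) ((gp_hasSum hx.1.le).summable.mul_right M)
    exact mul_le_mul_of_nonneg_left (h1 _ (gu_mem n hx)) (gp_nonneg n hx.1.le)
  have hE : UE (fun y => ENNReal.ofReal (h y)) x = ENNReal.ofReal (∑' n, gp n x * h (gu n x)) := by
    rw [ENNReal.ofReal_tsum_of_nonneg hnn hs]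
    unfold UE
    congr 1; funext n
    rw [ENNReal.ofReal_mul (gp_nonneg n hx.1.le)]
  have hR : UR h x = ∑' n, gp n x * h (gu n x) := by
    unfold UR; rw [hE, ENNReal.toReal_ofReal (tsum_nonneg hnn)]
  rw [hR]
  exact ⟨hs.hasSum, hE⟩

lemma measurable_gp (n : ℕ) : Measurable (gp n) := by unfold gp; fun_prop
lemma measurable_gu (n : ℕ) : Measurable (gu n) := by unfold gu; fun_prop
lemma measurable_UE {h : ℝ → ℝ≥0∞} (hh : Measurable h) : Measurable (UE h) := by
  unfold UE
  apply Measurable.tsum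
  intro n
  exact ((measurable_gp n).ennreal_ofReal).mul (hh.comp (measurable_gu n))
lemma measurable_UR {h : ℝ → ℝ} (hh : Measurable h) : Measurable (UR h) :=
  (measurable_UE hh.ennreal_ofReal).ennreal_toReal

lemma Cone.le_two {f : ℝ → ℝ} (hf : Cone f) {x y : ℝ} (hx : x ∈ Ioo (0:ℝ) 1) (hy : y ∈ Ioo (0:ℝ) 1) :
    f x ≤ 2 * f y := by
  have h1 := hf.nonneg x hx
  have h2 := hf.nonneg y hy
  obtain ⟨hx0, hx1⟩ := id hx
  obtain ⟨hy0, hy1⟩ := id hy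
  rcases le_total x y with h | h
  · have := hf.up x hx y hy h; nlinarith
  · have := hf.down y hy x hx h; nlinarith

lemma Cone.bdd {f : ℝ → ℝ} (hf : Cone f) : ∀ x ∈ Ioo (0:ℝ) 1, f x ≤ 2 * f (1/2) :=
  fun _ hx => hf.le_two hx (by norm_num)

/-- the cone is preserved by weighted branches -/
lemma cone_UR {f h : ℝ → ℝ} (hf : Cone f) (hm : Measurable h) (b : ℕ → ℝ) (hb0 : ∀ n, 0 ≤ b n)
    (hh0 : ∀ x ∈ Ioo (0:ℝ) 1, 0 ≤ h x) (hh1 : ∀ x ∈ Ioo (0:ℝ) 1, h x ≤ f x)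
    (hh : ∀ n, ∀ x ∈ Ioo (0:ℝ) 1, h (gu n x) = b n * f (gu n x)) : Cone (UR h) := by
  have S := fun {x : ℝ} (hx : x ∈ Ioo (0:ℝ) 1) =>
    (UR_spec hh0 (fun x hx => (hh1 x hx).trans (hf.bdd x hx)) hx).1
  refine ⟨measurable_UR hm, fun x _ => ENNReal.toReal_nonneg, ?_, ?_⟩
  · intro x hx y hy hxy
    refine hasSum_le (fun n => ?_) ((S hx).mul_left (1+x)) ((S hy).mul_left (1+y))
    rw [hh n x hx, hh n y hy]
    have key := hf.down _ (gu_mem n hy) _ (gu_mem n hx) (gu_anti n hx.1.le hxy)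
    have hn : (0:ℝ) ≤ n := n.cast_nonneg
    have hx0 := hx.1; have hy0 := hy.1
    set A := f (gu n x); set B := f (gu n y)
    have hB : 0 ≤ B := hf.nonneg _ (gu_mem n hy)
    have e1 : (1 + x) * (gp n x * (b n * A)) =
      b n * (((1+x)/(x+n+1))^2 * (A / (1 + gu n x))) := by
      unfold gp gu; field_simp; ring
    have e2 : (1 + y) * (gp n y * (b n * B)) =
      b n * (((1+y)/(y+n+1))^2 * (B / (1 + gu n y))) := by
      unfold gp gu; field_simp; ring
    have p1 := (gu_mem n hx).1
    have p2 := (gu_mem n hy).1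
    rw [e1, e2]
    apply mul_le_mul_of_nonneg_left _ (hb0 n)
    apply mul_le_mul
    · gcongr ?_ ^ 2
      rw [div_le_div_iff₀ (by positivity) (by positivity)]
      nlinarith
    · rw [div_le_div_iff₀ (by positivity) (by positivity)]
      linarith
    · exact div_nonneg (hf.nonneg _ (gu_mem n hx)) (by positivity)
    · positivity
  · intro x hx y hy hxy
    refine hasSum_le (fun n => ?_) ((S hy).mul_left (1+x)) ((S hx).mul_left (1+y))
    rw [hh n x hx, hh n y hy]
    have key := hf.up _ (gu_mem n hy) _ (gu_mem n hx) (gu_anti n hx.1.le hxy)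
    have hn : (0:ℝ) ≤ n := n.cast_nonneg
    have hx0 := hx.1; have hy0 := hy.1
    set A := f (gu n x); set B := f (gu n y)
    have hB : 0 ≤ B := hf.nonneg _ (gu_mem n hy)
    have e1 : (1 + y) * (gp n x * (b n * A)) =
      b n * (1+x) * (1 + y) * ((1/(x+n+2))^2 * ((1 + gu n x) * A)) := by
      unfold gp gu; field_simp; ring
    have e2 : (1 + x) * (gp n y * (b n * B)) =
      b n * (1+x) * (1 + y) * ((1/(y+n+2))^2 * ((1 + gu n y) * B)) := by
      unfold gp gu; field_simp; ring
    have p1 := (gu_mem n hx).1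
    have p2 := (gu_mem n hy).1
    rw [e1, e2]
    have := hb0 n
    apply mul_le_mul_of_nonneg_left _ (by positivity)
    apply mul_le_mul _ key (by positivity) (by positivity)
    gcongr

lemma cone_UR' {f : ℝ → ℝ} (hf : Cone f) : Cone (UR f) :=
  cone_UR hf hf.meas (fun _ => 1) (by simp) hf.nonneg (fun _ _ => le_rfl) (by simp)

def RLip (L : ℝ) (f : ℝ → ℝ) : Prop :=
  ∀ x ∈ Ioo (0:ℝ) 1, ∀ y ∈ Ioo (0:ℝ) 1, x ≤ y → |f x - f y| ≤ L * (rho y - rho x)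

lemma rho_diff {x y : ℝ} (hx : 0 < x) (hxy : x ≤ y) :
    0 ≤ 1/(1+x) - 1/(1+y) ∧ rho y - rho x = (y - x) + (1/(1+x) - 1/(1+y)) ∧
    1/(1+x) - 1/(1+y) ≤ y - x := by
  have hy : 0 < y := by linarith
  refine ⟨?_, ?_, ?_⟩
  · rw [sub_nonneg]; gcongr
  · unfold rho; field_simp; ring
  · have : 1/(1+x) - 1/(1+y) = (y-x)/((1+x)*(1+y)) := by field_simp; ring
    rw [this]
    apply div_le_self (by linarith)
    nlinarith [mul_pos hx hy]

lemma rlip_UR {f : ℝ → ℝ} (hf : Cone f) {L : ℝ} (hL : 0 ≤ L) (h : RLip L f) : RLip (L/2) (UR f) := by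
  intro x hx y hy hxy
  have S := fun {x : ℝ} (hx : x ∈ Ioo (0:ℝ) 1) =>
    (UR_spec hf.nonneg hf.bdd hx).1
  have R := fun {x : ℝ} (hx : x ∈ Ioo (0:ℝ) 1) => (rho_hasSum hx.1.le).mul_left L
  have h1 := mono_key (f := fun x => L * rho x + f x) (a := L * (1/(1+x)) + UR f x) (b := L * (1/(1+y)) + UR f y)
    (by
      intro x hx y hy hxy
      have := abs_le.1 (h x hx y hy hxy)
      linarith [this.1, this.2]) hx hy hxy
    (((R hx).add (S hx)).congr_fun' (fun n => by ring))
    (((R hy).add (S hy)).congr_fun' (fun n => by ring))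
  have h2 := mono_key (f := fun x => L * rho x - f x) (a := L * (1/(1+x)) - UR f x) (b := L * (1/(1+y)) - UR f y)
    (by
      intro x hx y hy hxy
      have := abs_le.1 (h x hx y hy hxy)
      linarith [this.1, this.2]) hx hy hxy
    (((R hx).sub (S hx)).congr_fun' (fun n => by ring))
    (((R hy).sub (S hy)).congr_fun' (fun n => by ring))
  obtain ⟨r1, r2, r3⟩ := rho_diff hx.1 hxy
  rw [r2]
  have : L * (1/(1+x) - 1/(1+y)) ≤ L/2 * ((y - x) + (1/(1+x) - 1/(1+y))) := by
    nlinarith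
  rw [abs_le]
  constructor <;> linarith

lemma iter_UR {f : ℝ → ℝ} (hf : Cone f) {L : ℝ} (hL : 0 ≤ L) (h : RLip L f) (d : ℕ) :
    Cone (UR^[d] f) ∧ RLip (L / 2^d) (UR^[d] f) := by
  induction d with
  | zero => simpa using ⟨hf, h⟩
  | succ d ih =>
    rw [Function.iterate_succ_apply']
    refine ⟨cone_UR' ih.1, ?_⟩
    have := rlip_UR ih.1 (by positivity) ih.2
    rwa [div_div, ← pow_succ] at this

lemma Cone.rlip {f : ℝ → ℝ} (hf : Cone f) {M : ℝ} (hM : ∀ x ∈ Ioo (0:ℝ) 1, f x ≤ M) : RLip M f := by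
  intro x hx y hy hxy
  obtain ⟨r1, r2, r3⟩ := rho_diff hx.1 hxy
  have h1 := hf.up x hx y hy hxy
  have h2 := hf.down x hx y hy hxy
  have n1 := hf.nonneg x hx
  have n2 := hf.nonneg y hy
  have m1 := hM x hx
  have m2 := hM y hy
  have : M * (y - x) ≤ M * (rho y - rho x) := by
    apply mul_le_mul_of_nonneg_left _ (n1.trans m1); linarith
  have hx0 := hx.1
  have q1 : (y - x) * f x ≤ (y - x) * M := mul_le_mul_of_nonneg_left m1 (by linarith)
  have q2 : (y - x) * f y ≤ (y - x) * M := mul_le_mul_of_nonneg_left m2 (by linarith)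
  have q0 : 0 ≤ (y - x) * f x := mul_nonneg (by linarith) n1
  have q0' : 0 ≤ (y - x) * f y := mul_nonneg (by linarith) n2
  rw [abs_le]
  constructor
  · rcases le_total (f y) (f x) with h | h
    · linarith
    · nlinarith [mul_nonneg hx0.le (sub_nonneg.2 h)]
  · rcases le_total (f x) (f y) with h | h
    · linarith
    · nlinarith [mul_nonneg hx0.le (sub_nonneg.2 h)]

lemma RLip.osc {f : ℝ → ℝ} {L : ℝ} (hL : 0 ≤ L) (h : RLip L f) {x y : ℝ} (hx : x ∈ Ioo (0:ℝ) 1)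
    (hy : y ∈ Ioo (0:ℝ) 1) : |f x - f y| ≤ L * 2 := by
  wlog hxy : x ≤ y generalizing x y
  · rw [abs_sub_comm]; exact this hy hx (by linarith)
  refine (h x hx y hy hxy).trans ?_
  apply mul_le_mul_of_nonneg_left _ hL
  obtain ⟨r1, r2, r3⟩ := rho_diff hx.1 hxy
  have := hx.1; have := hy.2
  linarith

lemma measurable_gw : Measurable (fun x : ℝ => ENNReal.ofReal (1 / ((1 + x) * Real.log 2))) := by
  fun_prop

lemma ae_Ioo : ∀ᵐ x ∂gaussμ, x ∈ Ioo (0:ℝ) 1 := by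
  unfold gaussμ
  apply (withDensity_absolutelyContinuous _ _).ae_le
  rw [← Measure.restrict_congr_set (Ioo_ae_eq_Ico (μ := (volume : Measure ℝ)) (a := 0) (b := 1))]
  exact ae_restrict_mem measurableSet_Ioo

lemma log2_pos : 0 < Real.log 2 := Real.log_pos (by norm_num)

instance gauss_prob : IsProbabilityMeasure gaussμ := by
  constructor
  unfold gaussμ
  rw [withDensity_apply _ MeasurableSet.univ, Measure.restrict_univ]
  have hl := log2_pos
  have hd : ∀ x ∈ uIcc (0:ℝ) 1, HasDerivAt (fun x => Real.log (1 + x) / Real.log 2)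
      (1 / ((1 + x) * Real.log 2)) x := by
    intro x hx
    rw [uIcc_of_le zero_le_one] at hx
    have : (1 + x) ≠ 0 := by have := hx.1; positivity
    have := (((hasDerivAt_id x).const_add 1).log this).div_const (Real.log 2)
    rw [← div_div]
    exact this
  have hc : ContinuousOn (fun x : ℝ => 1 / ((1 + x) * Real.log 2)) (uIcc 0 1) := by
    rw [uIcc_of_le zero_le_one]
    apply ContinuousOn.div continuousOn_const (by fun_prop)
    intro x hx
    have := hx.1
    positivity
  have hi := hc.intervalIntegrable (μ := volume)
  have h1 := intervalIntegral.integral_eq_sub_of_hasDerivAt hd hi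
  rw [setLIntegral_congr Ico_ae_eq_Ioc, ← ofReal_integral_eq_lintegral_ofReal]
  · rw [← intervalIntegral.integral_of_le zero_le_one, h1]
    norm_num [div_self hl.ne']
  · exact (intervalIntegrable_iff_integrableOn_Ioc_of_le zero_le_one).1 hi
  · filter_upwards [ae_restrict_mem measurableSet_Ioc] with x hx
    have := hx.1
    have hx1 : 0 < 1 + x := by linarith
    exact (div_pos one_pos (mul_pos hx1 hl)).le

lemma measurable_gaussMap : Measurable gaussMap := by
  unfold gaussMap
  refine Measurable.ite (measurableSet_singleton _) measurable_const ?_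
  have : Measurable (fun x : ℝ => 1 / x) := by fun_prop
  refine this.sub ?_
  exact (measurable_from_top (f := fun z : ℤ => (z:ℝ))).comp (Int.measurable_floor.comp this)

lemma floor_gu (n : ℕ) {x : ℝ} (hx : x ∈ Ico (0:ℝ) 1) : ⌊1 / gu n x⌋ = n + 1 := by
  unfold gu
  rw [one_div_one_div, Int.floor_eq_iff]
  push_cast
  constructor <;> linarith [hx.1, hx.2]

lemma gaussMap_gu (n : ℕ) {x : ℝ} (hx : x ∈ Ico (0:ℝ) 1) : gaussMap (gu n x) = x := by
  have h := floor_gu n hx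
  have : gu n x ≠ 0 := by
    unfold gu
    have := hx.1
    positivity
  rw [gaussMap, if_neg this, h]
  unfold gu
  rw [one_div_one_div]; push_cast; ring

lemma iUnion_gu : (⋃ n, gu n '' Ico (0:ℝ) 1) = Ioc (0:ℝ) 1 := by
  ext y
  simp only [mem_iUnion, mem_image]
  constructor
  · rintro ⟨n, x, hx, rfl⟩
    have := hx.1
    unfold gu
    refine ⟨by positivity, ?_⟩
    rw [div_le_one (by positivity)]
    have : (0:ℝ) ≤ n := n.cast_nonneg
    linarith
  · intro hy
    have h1 : 1 ≤ 1 / y := by rw [le_div_iff₀ hy.1]; linarith [hy.2]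
    have h2 : 1 ≤ ⌊1 / y⌋₊ := Nat.le_floor (by simpa using h1)
    refine ⟨⌊1 / y⌋₊ - 1, 1 / y - ⌊1 / y⌋₊, ⟨?_, ?_⟩, ?_⟩
    · rw [sub_nonneg]; exact Nat.floor_le (by positivity)
    · linarith [Nat.lt_floor_add_one (1 / y)]
    · unfold gu; push_cast [Nat.cast_sub h2]
      simp

lemma dualE {h g : ℝ → ℝ≥0∞} (hh : Measurable h) (hg : Measurable g) :
    ∫⁻ x, h x * g (gaussMap x) ∂gaussμ = ∫⁻ x, UE h x * g x ∂gaussμ := by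
  have hgT : Measurable (fun x => g (gaussMap x)) := hg.comp measurable_gaussMap
  unfold gaussμ
  have l1 := lintegral_withDensity_eq_lintegral_mul (volume.restrict (Ico (0:ℝ) 1)) measurable_gw
    (hh.mul hgT)
  have l2 := lintegral_withDensity_eq_lintegral_mul (volume.restrict (Ico (0:ℝ) 1)) measurable_gw
    ((measurable_UE hh).mul hg)
  refine l1.trans (Eq.trans ?_ l2.symm)
  rw [setLIntegral_congr Ico_ae_eq_Ioc, ← iUnion_gu]
  have hinj : ∀ n, InjOn (gu n) (Ico (0:ℝ) 1) := by
    intro n x hx y hy hxy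
    rw [← gaussMap_gu n hx, hxy, gaussMap_gu n hy]
  rw [lintegral_iUnion]
  rotate_left
  · intro n
    exact measurableSet_Ico.image_of_measurable_injOn (measurable_gu n) (hinj n)
  · intro n m hnm
    rw [Function.onFun, Set.disjoint_left]
    rintro _ ⟨x, hx, rfl⟩ ⟨y, hy, hxy⟩
    apply hnm
    have h1 := floor_gu n hx
    rw [← hxy, floor_gu m hy] at h1
    omega
  have hder : ∀ n : ℕ, ∀ x ∈ Ico (0:ℝ) 1, HasDerivWithinAt (gu n) (-1 / (x + n + 1)^2) (Ico (0:ℝ) 1) x := by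
    intro n x hx
    have hne : x + n + 1 ≠ 0 := by have := hx.1; positivity
    have := (((hasDerivAt_id x).add_const (n:ℝ)).add_const 1).inv hne
    apply HasDerivAt.hasDerivWithinAt
    have e : gu n = (fun x : ℝ => id x + (n:ℝ) + 1)⁻¹ := by
      funext x; simp [gu]
    rw [e]
    exact this
  simp_rw [fun n => lintegral_image_eq_lintegral_abs_deriv_mul measurableSet_Ico (hder n) (hinj n)]
  rw [← lintegral_tsum]
  · apply setLIntegral_congr_fun measurableSet_Ico
    intro x hx
    simp only [Pi.mul_apply]
    unfold UE
    rw [← ENNReal.tsum_mul_right, ← ENNReal.tsum_mul_left]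
    congr 1; funext n
    rw [gaussMap_gu n hx]
    have hx0 := hx.1
    have hl := log2_pos
    have e : |-1 / (x + n + 1)^2| * (1 / ((1 + gu n x) * Real.log 2)) =
        1 / ((1 + x) * Real.log 2) * gp n x := by
      rw [abs_div, abs_neg, abs_one, abs_of_nonneg (by positivity)]
      unfold gu gp
      field_simp
      ring
    rw [← mul_assoc, ← ENNReal.ofReal_mul (abs_nonneg _), e, ENNReal.ofReal_mul (by positivity)]
    ring
  · intro n
    apply Measurable.aemeasurable
    refine Measurable.mul (by fun_prop) ?_
    exact ((measurable_gw.mul (hh.mul hgT))).comp (measurable_gu n)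

lemma dualR {f : ℝ → ℝ} (hm : Measurable f) (h0 : ∀ x ∈ Ioo (0:ℝ) 1, 0 ≤ f x) {M : ℝ}
    (h1 : ∀ x ∈ Ioo (0:ℝ) 1, f x ≤ M) {g : ℝ → ℝ≥0∞} (hg : Measurable g) :
    ∫⁻ x, ENNReal.ofReal (f x) * g (gaussMap x) ∂gaussμ =
      ∫⁻ x, ENNReal.ofReal (UR f x) * g x ∂gaussμ := by
  rw [dualE hm.ennreal_ofReal hg]
  apply lintegral_congr_ae
  filter_upwards [ae_Ioo] with x hx
  rw [(UR_spec h0 h1 hx).2]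

lemma dual_iter {f : ℝ → ℝ} (hf : Cone f) {g : ℝ → ℝ≥0∞} (hg : Measurable g) (d : ℕ) :
    ∫⁻ x, ENNReal.ofReal (f x) * g (gaussMap^[d] x) ∂gaussμ =
      ∫⁻ x, ENNReal.ofReal (UR^[d] f x) * g x ∂gaussμ := by
  induction d generalizing f with
  | zero => simp
  | succ d ih =>
    simp only [Function.iterate_succ_apply]
    rw [← ih (cone_UR' hf)]
    exact dualR hf.meas hf.nonneg hf.bdd (g := fun x => g (gaussMap^[d] x))
      (hg.comp (measurable_gaussMap.iterate d))

lemma cone_one : Cone (fun _ => (1:ℝ)) := by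
  refine ⟨measurable_const, by simp, ?_, ?_⟩ <;> intros <;> linarith

lemma UR_one {x : ℝ} (hx : x ∈ Ioo (0:ℝ) 1) : UR (fun _ => (1:ℝ)) x = 1 := by
  have h := (UR_spec cone_one.nonneg cone_one.bdd hx).1
  have h2 := gp_hasSum hx.1.le
  simp only [mul_one] at h
  exact h.unique h2

lemma invar {g : ℝ → ℝ≥0∞} (hg : Measurable g) (d : ℕ) :
    ∫⁻ x, g (gaussMap^[d] x) ∂gaussμ = ∫⁻ x, g x ∂gaussμ := by
  induction d with
  | zero => simp
  | succ d ih =>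
    simp only [Function.iterate_succ_apply]
    rw [← ih]
    have := dualR (f := fun _ => (1:ℝ)) measurable_const cone_one.nonneg cone_one.bdd
      (g := fun x => g (gaussMap^[d] x)) (hg.comp (measurable_gaussMap.iterate d))
    simp only [ENNReal.ofReal_one, one_mul] at this
    rw [this]
    apply lintegral_congr_ae
    filter_upwards [ae_Ioo] with x hx
    rw [UR_one hx]; simp

lemma mean_osc {f : ℝ → ℝ} (h0 : ∀ x ∈ Ioo (0:ℝ) 1, 0 ≤ f x)
    {ε m : ℝ} (hm : 0 ≤ m) (hint : ∫⁻ x, ENNReal.ofReal (f x) ∂gaussμ = ENNReal.ofReal m)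
    (hε : ∀ x ∈ Ioo (0:ℝ) 1, ∀ y ∈ Ioo (0:ℝ) 1, |f x - f y| ≤ ε) {x : ℝ} (hx : x ∈ Ioo (0:ℝ) 1) :
    |f x - m| ≤ ε := by
  have he : 0 ≤ ε := (abs_nonneg _).trans (hε x hx x hx)
  have a1 : ENNReal.ofReal m ≤ ENNReal.ofReal (f x + ε) := by
    rw [← hint]
    calc _ ≤ ∫⁻ _, ENNReal.ofReal (f x + ε) ∂gaussμ := by
          apply lintegral_mono_ae
          filter_upwards [ae_Ioo] with y hy
          apply ENNReal.ofReal_le_ofReal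
          linarith [(abs_le.1 (hε x hx y hy)).1]
      _ = _ := by simp
  have a2 : ENNReal.ofReal (f x - ε) ≤ ENNReal.ofReal m := by
    rw [← hint]
    calc _ = ∫⁻ _, ENNReal.ofReal (f x - ε) ∂gaussμ := by simp
      _ ≤ _ := by
          apply lintegral_mono_ae
          filter_upwards [ae_Ioo] with y hy
          apply ENNReal.ofReal_le_ofReal
          linarith [(abs_le.1 (hε x hx y hy)).2]
  rw [ENNReal.ofReal_le_ofReal_iff (by linarith [h0 x hx])] at a1
  rw [ENNReal.ofReal_le_ofReal_iff hm] at a2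
  rw [abs_le]; constructor <;> linarith

/-- key mixing estimate: after `d` steps a cone function is close to its mean -/
lemma mix {f : ℝ → ℝ} (hf : Cone f) {m : ℝ} (hm : 0 ≤ m)
    (hint : ∫⁻ x, ENNReal.ofReal (f x) ∂gaussμ = ENNReal.ofReal m) (d : ℕ) {x : ℝ}
    (hx : x ∈ Ioo (0:ℝ) 1) : |UR^[d] f x - m| ≤ 4 * m / 2 ^ d := by
  have hM : ∀ x ∈ Ioo (0:ℝ) 1, f x ≤ 2 * m := by
    intro x hx
    have : ENNReal.ofReal (f x / 2) ≤ ENNReal.ofReal m := by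
      rw [← hint]
      calc _ = ∫⁻ _, ENNReal.ofReal (f x / 2) ∂gaussμ := by simp
        _ ≤ _ := by
          apply lintegral_mono_ae
          filter_upwards [ae_Ioo] with y hy
          apply ENNReal.ofReal_le_ofReal
          linarith [hf.le_two hx hy]
    rw [ENNReal.ofReal_le_ofReal_iff hm] at this
    linarith
  obtain ⟨hc, hl⟩ := iter_UR hf (by positivity) (hf.rlip hM) d
  have hi : ∫⁻ x, ENNReal.ofReal (UR^[d] f x) ∂gaussμ = ENNReal.ofReal m := by
    rw [← hint]
    simpa using (dual_iter hf (g := fun _ => 1) measurable_const d).symm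
  refine mean_osc hc.nonneg hm hi (fun x hx y hy => ?_) hx
  refine (hl.osc (by positivity) hx hy).trans (le_of_eq ?_)
  ring

def BB (c : ℝ) : Set ℝ := {y | c ≤ ((⌊1 / y⌋₊ : ℕ) : ℝ)}

lemma measurableSet_BB (c : ℝ) : MeasurableSet (BB c) := by
  have h1 : Measurable (fun y : ℝ => ((⌊1 / y⌋₊ : ℕ) : ℝ)) := by
    have : Measurable (fun x : ℝ => 1 / x) := by fun_prop
    exact (measurable_from_top (f := fun z : ℕ => (z:ℝ))).comp (Nat.measurable_floor.comp this)
  exact measurableSet_le measurable_const h1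

lemma nfloor_gu (n : ℕ) {x : ℝ} (hx : x ∈ Ioo (0:ℝ) 1) : ⌊1 / gu n x⌋₊ = n + 1 := by
  have := floor_gu n (Ioo_subset_Ico_self hx)
  rw [← Int.floor_toNat, this]
  omega

def HD (E : Set ℝ) (k : ℕ) (F : ℝ → ℝ) : Prop :=
  ∀ g : ℝ → ℝ≥0∞, Measurable g →
    ∫⁻ x, E.indicator 1 x * g (gaussMap^[k] x) ∂gaussμ = ∫⁻ x, ENNReal.ofReal (F x) * g x ∂gaussμ

lemma step {E : Set ℝ} (hE : MeasurableSet E) {k : ℕ} {F : ℝ → ℝ} (hF : Cone F) (H : HD E k F)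
    (d : ℕ) (c : ℝ) :
    (∃ F', Cone F' ∧ HD (E ∩ (gaussMap^[k + d]) ⁻¹' (BB c)) (k + d + 1) F') ∧
    |gaussμ.real (E ∩ (gaussMap^[k + d]) ⁻¹' (BB c)) - gaussμ.real E * gaussμ.real (BB c)| ≤
      4 / 2 ^ d * (gaussμ.real E * gaussμ.real (BB c)) := by
  have hB := measurableSet_BB c
  set B := BB c with hBdef
  set G := UR^[d] F with hG
  have hGc : Cone G := (iter_UR hF (L := 2 * F (1/2))
    (by have := hF.nonneg (1/2) (by norm_num); positivity) (hF.rlip hF.bdd) d).1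
  have hEm : ∫⁻ x, ENNReal.ofReal (F x) ∂gaussμ = ENNReal.ofReal (gaussμ.real E) := by
    have := H (fun _ => 1) measurable_const
    simp only [mul_one] at this
    rw [← this, lintegral_indicator_one hE, ofReal_measureReal]
  have key : ∀ g : ℝ → ℝ≥0∞, Measurable g →
      ∫⁻ x, (E ∩ (gaussMap^[k + d]) ⁻¹' B).indicator 1 x * g (gaussMap^[k + d] x) ∂gaussμ =
      ∫⁻ x, ENNReal.ofReal (G x) * (B.indicator 1 x * g x) ∂gaussμ := by
    intro g hg
    have hm : Measurable (fun x => B.indicator 1 x * g x) :=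
      (measurable_one.indicator hB).mul hg
    rw [← dual_iter hF hm d]
    refine Eq.trans ?_ (H _ (hm.comp (measurable_gaussMap.iterate d)))
    congr 1; funext x
    have e : gaussMap^[k + d] x = gaussMap^[d] (gaussMap^[k] x) := by
      rw [add_comm, Function.iterate_add_apply]
    simp only [Function.comp, ← e]
    rw [← mul_assoc, Set.inter_indicator_one]
    rfl
  refine ⟨⟨UR (B.indicator G), ?_, ?_⟩, ?_⟩
  · refine cone_UR hGc (hGc.meas.indicator hB) (fun n => if c ≤ ((n + 1 : ℕ) : ℝ) then 1 else 0) ?_ ?_ ?_ ?_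
    · intro n; split_ifs <;> norm_num
    · intro x hx
      by_cases h : x ∈ B
      · simpa [h] using hGc.nonneg x hx
      · simp [h]
    · intro x hx
      by_cases h : x ∈ B
      · simp [h]
      · simpa [h] using hGc.nonneg x hx
    · intro n x hx
      have : gu n x ∈ B ↔ c ≤ ((n + 1 : ℕ) : ℝ) := by
        rw [hBdef, BB, mem_ofPred_eq, nfloor_gu n hx]
      by_cases h : gu n x ∈ B
      · rw [Set.indicator_of_mem h, if_pos (this.1 h), one_mul]
      · rw [Set.indicator_of_notMem h, if_neg (fun h' => h (this.2 h')), zero_mul]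
  · intro g hg
    have := dualR (f := B.indicator G) (M := 2 * G (1/2)) (hGc.meas.indicator hB)
      (fun x hx => by
        by_cases h : x ∈ B
        · simpa [h] using hGc.nonneg x hx
        · simp [h])
      (fun x hx => by
        by_cases h : x ∈ B
        · simpa [h] using hGc.bdd x hx
        · simpa [h] using hGc.nonneg (1/2) (by norm_num)) hg
    rw [← this]
    simp only [Function.iterate_succ_apply']
    rw [key (fun x => g (gaussMap x)) (hg.comp measurable_gaussMap)]
    congr 1; funext x
    by_cases h : x ∈ B <;> simp [h]
  · have hEB : MeasurableSet (E ∩ (gaussMap^[k + d]) ⁻¹' B) :=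
      hE.inter ((measurable_gaussMap.iterate _) hB)
    have h1 := key (fun _ => 1) measurable_const
    simp only [mul_one] at h1
    rw [lintegral_indicator_one hEB] at h1
    set m := gaussμ.real E with hmdef
    have hm : 0 ≤ m := measureReal_nonneg
    have hb : 0 ≤ gaussμ.real B := measureReal_nonneg
    have hmix : ∀ x ∈ Ioo (0:ℝ) 1, |G x - m| ≤ 4 * m / 2 ^ d := fun x hx => mix hF hm hEm d hx
    have up : ENNReal.ofReal (gaussμ.real (E ∩ (gaussMap^[k + d]) ⁻¹' B)) ≤
        ENNReal.ofReal ((m + 4 * m / 2 ^ d) * gaussμ.real B) := by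
      rw [ofReal_measureReal, h1, ENNReal.ofReal_mul (by positivity), ofReal_measureReal,
        ← lintegral_indicator_one hB, ← lintegral_const_mul _ (measurable_one.indicator hB)]
      apply lintegral_mono_ae
      filter_upwards [ae_Ioo] with x hx
      gcongr
      linarith [(abs_le.1 (hmix x hx)).2]
    have lo : ENNReal.ofReal ((m - 4 * m / 2 ^ d) * gaussμ.real B) ≤
        ENNReal.ofReal (gaussμ.real (E ∩ (gaussMap^[k + d]) ⁻¹' B)) := by
      rw [ofReal_measureReal, h1, ENNReal.ofReal_mul' (by positivity), ofReal_measureReal,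
        ← lintegral_indicator_one hB, ← lintegral_const_mul _ (measurable_one.indicator hB)]
      apply lintegral_mono_ae
      filter_upwards [ae_Ioo] with x hx
      gcongr
      linarith [(abs_le.1 (hmix x hx)).1]
    rw [ENNReal.ofReal_le_ofReal_iff (by positivity)] at up
    rw [ENNReal.ofReal_le_ofReal_iff measureReal_nonneg] at lo
    have e : 4 * m / 2 ^ d = 4 / 2 ^ d * m := by ring
    rw [e] at up lo
    rw [abs_le]; constructor <;> linarith

/-- the intersection event -/
def EE (c : ℝ) (k : ℕ → ℕ) (r : ℕ) : Set ℝ := {x | ∀ j ∈ Finset.Icc 1 r, gaussMap^[k j - 1] x ∈ BB c}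

lemma EE_succ (c : ℝ) (k : ℕ → ℕ) (r : ℕ) :
    EE c k (r + 1) = EE c k r ∩ (gaussMap^[k (r+1) - 1]) ⁻¹' (BB c) := by
  ext x
  simp only [EE, mem_ofPred_eq, mem_inter_iff, mem_preimage, Finset.mem_Icc]
  constructor
  · intro h
    exact ⟨fun j hj => h j ⟨hj.1, by omega⟩, h _ ⟨by omega, le_rfl⟩⟩
  · rintro ⟨h1, h2⟩ j hj
    rcases Nat.lt_or_ge r j with h | h
    · have : j = r + 1 := by omega
      rwa [this]
    · exact h1 j ⟨hj.1, h⟩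

lemma measurableSet_EE (c : ℝ) (k : ℕ → ℕ) (r : ℕ) : MeasurableSet (EE c k r) := by
  induction r with
  | zero => simp [EE]
  | succ r ih =>
    rw [EE_succ]
    exact ih.inter ((measurable_gaussMap.iterate _) (measurableSet_BB c))

lemma Aset_eq (ψ : ℕ → ℝ) (n k : ℕ) :
    Aset ψ n k = Ico (0:ℝ) 1 ∩ (gaussMap^[k - 1]) ⁻¹' (BB (ψ n)) := rfl

lemma gauss_inter (ψ : ℕ → ℝ) (n r : ℕ) (k : ℕ → ℕ) :
    gaussμ (⋂ j ∈ Finset.Icc 1 r, Aset ψ n (k j)) = gaussμ (EE (ψ n) k r) := by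
  apply measure_congr
  filter_upwards [ae_Ioo] with x hx
  have : (x ∈ ⋂ j ∈ Finset.Icc 1 r, Aset ψ n (k j)) ↔ x ∈ EE (ψ n) k r := by
    simp only [mem_iInter, EE, mem_ofPred_eq, Aset_eq, mem_inter_iff, mem_preimage]
    exact ⟨fun h j hj => (h j hj).2, fun h j hj => ⟨Ioo_subset_Ico_self hx, h j hj⟩⟩
  exact propext this

lemma gauss_A1 (ψ : ℕ → ℝ) (n : ℕ) : gaussμ (Aset ψ n 1) = gaussμ (BB (ψ n)) := by
  apply measure_congr
  filter_upwards [ae_Ioo] with x hx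
  have : (x ∈ Aset ψ n 1) ↔ x ∈ BB (ψ n) := by
    simp only [Aset_eq, mem_inter_iff, mem_preimage]
    exact ⟨fun h => h.2, fun h => ⟨Ioo_subset_Ico_self hx, h⟩⟩
  exact propext this

lemma log_bound {n : ℕ} (h : 3 + 2 * (Real.log n)^2 ≤ n) : 2 ≤ Real.log n := by
  have h3 : (3:ℝ) ≤ n := by nlinarith [sq_nonneg (Real.log n)]
  have hm : ∀ a : ℝ, 0 < a → a ≤ n → Real.log a ≤ Real.log n := fun a h0 ha => Real.log_le_log h0 ha
  have l2 := Real.log_two_gt_d9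
  have e1 : (1:ℝ) ≤ Real.log 3 := by
    rw [Real.le_log_iff_exp_le (by norm_num)]
    linarith [Real.exp_one_lt_d9]
  have e2 := hm 3 (by norm_num) h3
  have h5 : (5:ℝ) ≤ n := by nlinarith
  have e3 : 1.5 ≤ Real.log 5 := by
    rw [Real.le_log_iff_exp_le (by norm_num)]
    have : Real.exp 1.5 ^ 2 = Real.exp 1 ^ 3 := by
      rw [← Real.exp_nat_mul, ← Real.exp_nat_mul]; norm_num
    have h6 := Real.exp_one_lt_d9
    have h8 : Real.exp 1 ^ 3 ≤ 2.72 ^ 3 := by gcongr; linarith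
    have h7 := Real.exp_pos 1.5
    have h9 : (2.72:ℝ)^3 ≤ 25 := by norm_num
    by_contra hc
    push Not at hc
    nlinarith
  have e4 := hm 5 (by norm_num) h5
  have h7 : (7:ℝ) < n := by nlinarith
  have h8 : (8:ℝ) ≤ n := by
    have : 7 < n := by exact_mod_cast h7
    exact_mod_cast this
  have e5 := hm 8 (by norm_num) h8
  have : Real.log 8 = 3 * Real.log 2 := by
    rw [show (8:ℝ) = 2^3 by norm_num, Real.log_pow]; norm_num
  linarith

lemma rate {L : ℝ} (hL : 2 ≤ L) (d : ℕ) (hd : L^2 ≤ d) : (4:ℝ) / 2 ^ d ≤ (1/2 : ℝ) ^ L := by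
  have : (4:ℝ) / 2 ^ d = (1/2 : ℝ) ^ ((d:ℝ) - 2) := by
    rw [Real.rpow_sub (by norm_num), Real.rpow_natCast]
    rw [div_pow, one_pow, Real.div_rpow (by norm_num) (by norm_num)]
    norm_num
    ring
  rw [this]
  apply Real.rpow_le_rpow_of_exponent_ge (by norm_num) (by norm_num)
  nlinarith

theorem stmt_7 :
    ∃ C : ℝ, 0 < C ∧ ∃ γ : ℝ, 0 < γ ∧ γ < 1 ∧
      ∀ (ψ : ℕ → ℝ), (∀ n, 2 ≤ ψ n) → ∀ (n r : ℕ), 1 ≤ r → ∀ k : ℕ → ℕ,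
        k 0 = 1 → k 0 ≤ k 1 → (∀ j, 1 ≤ j → j < r → k j < k (j + 1)) → k r ≤ n →
        (∀ j < r, (Real.log n) ^ 2 ≤ (k (j + 1) : ℝ) - (k j : ℝ) - 1) →
        (gaussμ (Aset ψ n 1)).toReal ^ r * (1 - C * γ ^ (Real.log n)) ^ (r - 1) ≤
            (gaussμ (⋂ j ∈ Finset.Icc 1 r, Aset ψ n (k j))).toReal ∧
        (gaussμ (⋂ j ∈ Finset.Icc 1 r, Aset ψ n (k j))).toReal ≤
            (gaussμ (Aset ψ n 1)).toReal ^ r * (1 + C * γ ^ (Real.log n)) ^ (r - 1) := by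
  refine ⟨1, one_pos, 1/2, by norm_num, by norm_num, ?_⟩
  intro ψ _ n r hr k k0 _ hk hkn hgap
  rw [gauss_inter, gauss_A1]
  set c := ψ n
  set p := (gaussμ (BB c)).toReal with hp
  have hp0 : 0 ≤ p := ENNReal.toReal_nonneg
  have hk1 : 1 ≤ k 1 := by omega
  have base : gaussμ (EE c k 1) = gaussμ (BB c) := by
    have : EE c k 1 = (gaussMap^[k 1 - 1]) ⁻¹' (BB c) := by
      rw [EE_succ]; simp [EE]
    rw [this, ← lintegral_indicator_one (measurableSet_BB c),
      ← lintegral_indicator_one ((measurable_gaussMap.iterate _) (measurableSet_BB c))]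
    exact invar (measurable_one.indicator (measurableSet_BB c)) (k 1 - 1)
  have baseF : ∃ F, Cone F ∧ HD (EE c k 1) (k 1) F := by
    have h := (step (E := EE c k 0) (k := 0) (F := fun _ => 1) (measurableSet_EE c k 0) cone_one
      (by intro g _; simp [EE]) (k 1 - 1) c).1
    rw [zero_add, ← EE_succ, Nat.sub_add_cancel hk1] at h
    exact h
  rcases hr.eq_or_lt with h1 | h2
  · subst h1
    simp [base, hp]
  · have hmono : ∀ j, 2 ≤ j → j ≤ r → k 2 ≤ k j := by
      intro j hj hjr
      induction j, hj using Nat.le_induction with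
      | base => exact le_rfl
      | succ j hj ih => exact (ih (by omega)).trans (hk j (by omega) (by omega)).le
    have hL : 2 ≤ Real.log n := by
      apply log_bound
      have g0 := hgap 0 (by omega)
      have g1 := hgap 1 h2
      have : (k 2 : ℝ) ≤ n := by exact_mod_cast (hmono r h2 le_rfl).trans hkn
      rw [k0] at g0
      norm_num at g0 g1
      linarith
    set q := (1/2 : ℝ) ^ Real.log n
    have hq0 : 0 ≤ q := by positivity
    have hq1 : q ≤ 1 := Real.rpow_le_one (by norm_num) (by norm_num) (by linarith)
    have main : ∀ s, s + 1 ≤ r → (∃ F, Cone F ∧ HD (EE c k (s+1)) (k (s+1)) F) ∧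
        p ^ (s+1) * (1 - q) ^ s ≤ gaussμ.real (EE c k (s+1)) ∧
        gaussμ.real (EE c k (s+1)) ≤ p ^ (s+1) * (1 + q) ^ s := by
      intro s hs
      induction s with
      | zero =>
        refine ⟨baseF, ?_⟩
        simp [Measure.real, base, hp]
      | succ s ih =>
        obtain ⟨⟨F, hF, H⟩, lo, up⟩ := ih (by omega)
        have hlt := hk (s+1) (by omega) (by omega)
        have hg := hgap (s+1) (by omega)
        have st := step (measurableSet_EE c k (s+1)) hF H (k (s+1+1) - k (s+1) - 1) c
        have e1 : k (s+1) + (k (s+1+1) - k (s+1) - 1) = k (s+1+1) - 1 := by omega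
        have e2 : k (s+1+1) - 1 + 1 = k (s+1+1) := by omega
        rw [e1, e2, ← EE_succ] at st
        refine ⟨st.1, ?_⟩
        have hr := rate hL (k (s+1+1) - k (s+1) - 1) (by
          rw [Nat.cast_sub (by omega), Nat.cast_sub (by omega)]
          simpa using hg)
        have hst := st.2
        change |_ - _ * p| ≤ _ * (_ * p) at hst
        set m := gaussμ.real (EE c k (s+1))
        have hm : 0 ≤ m := measureReal_nonneg
        have hst2 := hst.trans (mul_le_mul_of_nonneg_right hr (mul_nonneg hm hp0))
        obtain ⟨a1, a2⟩ := abs_le.1 hst2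
        constructor
        · calc p ^ (s+1+1) * (1 - q) ^ (s+1) = (p ^ (s+1) * (1 - q) ^ s) * (p * (1 - q)) := by ring
            _ ≤ m * (p * (1 - q)) :=
              mul_le_mul_of_nonneg_right lo (mul_nonneg hp0 (by linarith))
            _ ≤ _ := by linarith
        · calc _ ≤ m * (p * (1 + q)) := by linarith
            _ ≤ (p ^ (s+1) * (1 + q) ^ s) * (p * (1 + q)) :=
              mul_le_mul_of_nonneg_right up (mul_nonneg hp0 (by linarith))
            _ = _ := by ring
    have := (main (r - 1) (by omega)).2
    rw [Nat.sub_add_cancel hr] at this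
    rw [one_mul]
    exact this
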